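/- Let n ≥ 1 and let β be an integer with 1 ≤ β ≤ n. There is a constant C(n,β) such that for all positive reals a_1 ≥ ... ≥ a_{n+1} with γ_i := a_i/a_{i+1} ≥ √2 for each i, S(β; a_1,...,a_{n+1}) ≤ C(n,β)·a_1^{−1}⋯a_β^{−1}·max_{r=β,...,n} max{1, ln γ_r}. -/

import Mathlib

open Real MeasureTheory Set

/-- `S β a` is the spherical-coordinates expression for the integral over the first
octant of `S^n` of the `β`-th power of the radial function of the rhombus with
vertices `±(1/aᵢ)eᵢ`:
`S(β; a₁,…,a_{n+1}) = ∫_{[0,π/2]^n} sin^{n−1}θ₁ ⋯ sin θ_{n−1}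
  / (a₁ cos θ₁ + a₂ sin θ₁ cos θ₂ + ⋯ + a_{n+1} sin θ₁ ⋯ sin θ_n)^β dθ₁⋯dθ_n`. -/
noncomputable def S (n : ℕ) (β : ℝ) (a : Fin (n+1) → ℝ) : ℝ :=
  ∫ θ in Set.univ.pi (fun _ : Fin n => Set.Icc 0 (π/2)),
    (∏ j : Fin n, Real.sin (θ j) ^ (n - 1 - (j : ℕ))) /
      (∑ i : Fin (n+1),
        a i * (∏ j : Fin n, if (j : ℕ) < (i : ℕ) then Real.sin (θ j) else 1) *
          (if h : (i : ℕ) < n then Real.cos (θ ⟨i, h⟩) else 1)) ^ β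

/-- The denominator of the integrand of `S`. -/
noncomputable def octantForm (n : ℕ) (a : Fin (n+1) → ℝ) (θ : Fin n → ℝ) : ℝ :=
  ∑ i : Fin (n+1),
    a i * (∏ j : Fin n, if (j : ℕ) < (i : ℕ) then Real.sin (θ j) else 1) *
      (if h : (i : ℕ) < n then Real.cos (θ ⟨i, h⟩) else 1)

/-- The spherical Jacobian in the integrand of `S`. -/
noncomputable def octantWeight (n : ℕ) (θ : Fin n → ℝ) : ℝ :=
  ∏ j : Fin n, Real.sin (θ j) ^ (n - 1 - (j : ℕ))

/-- Lebesgue measure on the open interval `(0, π/2)`. -/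
noncomputable def quarterMeasure : Measure ℝ := volume.restrict (Ioo 0 (π/2))

instance : IsFiniteMeasure quarterMeasure := by
  unfold quarterMeasure; infer_instance

/-- The integral `S` with values in the extended nonnegative reals. -/
noncomputable def octantLintegral (n β : ℕ) (a : Fin (n+1) → ℝ) : ENNReal :=
  ∫⁻ θ, ENNReal.ofReal (octantWeight n θ / octantForm n a θ ^ β)
    ∂(Measure.pi fun _ : Fin n => quarterMeasure)

lemma octantForm_cons (n : ℕ) (a : Fin (n+2) → ℝ) (t : ℝ) (y : Fin n → ℝ) :
    octantForm (n+1) a (Fin.cons t y : Fin (n+1) → ℝ) =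
      a 0 * cos t + octantForm n (Fin.tail a) y * sin t := by
  unfold octantForm
  rw [Fin.sum_univ_succ, Finset.sum_mul]
  congr 1
  · simp
  · refine Finset.sum_congr rfl fun i _ => ?_
    rw [Fin.prod_univ_succ]
    have h : (∏ j : Fin n, if ((j.succ : Fin (n+1)) : ℕ) < ((i.succ : Fin (n+2)) : ℕ) then
        sin ((Fin.cons t y : Fin (n+1) → ℝ) j.succ) else 1) =
        ∏ j : Fin n, if (j : ℕ) < (i : ℕ) then sin (y j) else 1 := by
      refine Finset.prod_congr rfl fun j _ => ?_
      simp
    rw [h]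
    have h2 : (if h : ((i.succ : Fin (n+2)) : ℕ) < n + 1 then
        cos ((Fin.cons t y : Fin (n+1) → ℝ) ⟨i.succ, h⟩) else 1) =
        if h : (i : ℕ) < n then cos (y ⟨i, h⟩) else 1 := by
      by_cases hi : (i : ℕ) < n
      · rw [dif_pos (by simpa using hi), dif_pos hi]
        exact congrArg cos (Fin.cons_succ (α := fun _ => ℝ) t y ⟨i, hi⟩)
      · rw [dif_neg (by simpa using hi), dif_neg hi]
    have h0 : (if ((0 : Fin (n+1)) : ℕ) < ((i.succ : Fin (n+2)) : ℕ) then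
        sin ((Fin.cons t y : Fin (n+1) → ℝ) 0) else 1) = sin t := by simp
    rw [h0, h2]
    have hring : ∀ A s P c : ℝ, A * (s * P) * c = A * P * c * s := fun A s P c => by ring
    exact hring _ _ _ _

lemma octantWeight_cons (n : ℕ) (t : ℝ) (y : Fin n → ℝ) :
    octantWeight (n+1) (Fin.cons t y : Fin (n+1) → ℝ) = sin t ^ n * octantWeight n y := by
  unfold octantWeight
  rw [Fin.prod_univ_succ]
  congr 1
  refine Finset.prod_congr rfl fun j _ => ?_
  rw [Fin.cons_succ]
  congr 1
  simp
  omega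

@[fun_prop]
lemma measurable_octantForm (n : ℕ) (a : Fin (n+1) → ℝ) : Measurable (octantForm n a) := by
  unfold octantForm
  refine Finset.measurable_sum _ fun i _ => ?_
  refine (measurable_const.mul (Finset.measurable_prod _ fun j _ => ?_)).mul ?_
  · split_ifs <;> fun_prop
  · split_ifs <;> fun_prop

@[fun_prop]
lemma measurable_octantWeight (n : ℕ) : Measurable (octantWeight n) := by
  unfold octantWeight
  fun_prop

lemma sin_pos_of_mem_quarter {t : ℝ} (ht : t ∈ Ioo 0 (π/2)) : 0 < sin t :=
  sin_pos_of_pos_of_lt_pi ht.1 (by linarith [ht.2, pi_pos])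

lemma cos_pos_of_mem_quarter {t : ℝ} (ht : t ∈ Ioo 0 (π/2)) : 0 < cos t :=
  cos_pos_of_mem_Ioo ⟨by linarith [ht.1, pi_pos], ht.2⟩

lemma octantForm_pos {n : ℕ} {a : Fin (n+1) → ℝ} (ha : ∀ i, 0 < a i) {θ : Fin n → ℝ}
    (hθ : ∀ i, θ i ∈ Ioo 0 (π/2)) : 0 < octantForm n a θ := by
  refine Finset.sum_pos (fun i _ => mul_pos (mul_pos (ha i) (Finset.prod_pos fun j _ => ?_)) ?_)
    Finset.univ_nonempty
  · split_ifs
    exacts [sin_pos_of_mem_quarter (hθ j), one_pos]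
  · split_ifs
    exacts [cos_pos_of_mem_quarter (hθ _), one_pos]

lemma octantWeight_nonneg {n : ℕ} {θ : Fin n → ℝ}
    (hθ : ∀ i, θ i ∈ Ioo 0 (π/2)) : 0 ≤ octantWeight n θ :=
  Finset.prod_nonneg fun j _ => pow_nonneg (sin_pos_of_mem_quarter (hθ j)).le _

lemma octantWeight_le_one {n : ℕ} {θ : Fin n → ℝ}
    (hθ : ∀ i, θ i ∈ Ioo 0 (π/2)) : octantWeight n θ ≤ 1 :=
  Finset.prod_le_one (fun j _ => pow_nonneg (sin_pos_of_mem_quarter (hθ j)).le _)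
    fun j _ => pow_le_one₀ (sin_pos_of_mem_quarter (hθ j)).le (sin_le_one _)

lemma pi_quarterMeasure (n : ℕ) : (Measure.pi fun _ : Fin n => quarterMeasure) =
    (volume : Measure (Fin n → ℝ)).restrict (univ.pi fun _ => Ioo 0 (π/2)) := by
  rw [volume_pi, Measure.restrict_pi_pi]
  rfl

lemma ae_mem_quarter (n : ℕ) : ∀ᵐ θ ∂(Measure.pi fun _ : Fin n => quarterMeasure),
    ∀ i, θ i ∈ Ioo 0 (π/2) := by
  rw [pi_quarterMeasure]
  filter_upwards [ae_restrict_mem (MeasurableSet.univ_pi fun _ => measurableSet_Ioo)] with θ hθ i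
  exact hθ i (mem_univ i)

lemma ae_mem_quarterMeasure : ∀ᵐ t ∂quarterMeasure, t ∈ Ioo 0 (π/2) :=
  ae_restrict_mem measurableSet_Ioo

lemma lintegral_pi_succ (n : ℕ) (μ : Measure ℝ) [SigmaFinite μ]
    {f : (Fin (n+1) → ℝ) → ENNReal} (hf : Measurable f) :
    ∫⁻ x, f x ∂(Measure.pi fun _ => μ) =
      ∫⁻ y, ∫⁻ t, f (Fin.cons t y : Fin (n+1) → ℝ) ∂μ ∂(Measure.pi fun _ : Fin n => μ) := by
  have h := (measurePreserving_piFinSuccAbove (fun _ : Fin (n+1) => μ) 0).symm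
  rw [← h.lintegral_comp hf, lintegral_prod_symm]
  · refine lintegral_congr fun y => lintegral_congr fun t => ?_
    exact congrArg f (Fin.insertNth_zero' t y)
  · exact (hf.comp (MeasurableEquiv.measurable _)).aemeasurable

/-- If `f ≤ g'` on `(0, π/2)`, then the integral of `f` is at most the increment of `g`. -/
lemma lintegral_quarter_le {f g g' : ℝ → ℝ} (hg : ContinuousOn g (Icc 0 (π/2)))
    (hg' : ∀ t ∈ Ioo 0 (π/2), HasDerivAt g (g' t) t) (h0 : ∀ t ∈ Ioo 0 (π/2), 0 ≤ g' t)
    (hfg : ∀ t ∈ Ioo 0 (π/2), f t ≤ g' t) :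
    ∫⁻ t, ENNReal.ofReal (f t) ∂quarterMeasure ≤ ENNReal.ofReal (g (π/2) - g 0) := by
  have hpi : (0 : ℝ) ≤ π/2 := by positivity
  have hint := intervalIntegral.integrableOn_deriv_of_nonneg hg hg' h0
  have hint' : Integrable g' quarterMeasure := hint.mono_set Ioo_subset_Ioc_self
  have key : ∫ t, g' t ∂quarterMeasure = g (π/2) - g 0 := by
    rw [← intervalIntegral.integral_eq_sub_of_hasDerivAt_of_le hpi hg hg'
      ((intervalIntegrable_iff_integrableOn_Ioc_of_le hpi).2 hint),
      intervalIntegral.integral_of_le hpi, integral_Ioc_eq_integral_Ioo]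
    rfl
  rw [← key, ofReal_integral_eq_lintegral_ofReal hint'
    (ae_mem_quarterMeasure.mono fun t ht => h0 t ht)]
  exact lintegral_mono_ae (ae_mem_quarterMeasure.mono fun t ht => ENNReal.ofReal_le_ofReal (hfg t ht))

lemma linear_form_pos {a b : ℝ} (ha : 0 < a) (hb : 0 < b) {t : ℝ} (ht : t ∈ Icc 0 (π/2)) :
    0 < a * cos t + b * sin t := by
  have hc : 0 ≤ cos t := cos_nonneg_of_mem_Icc ⟨by linarith [ht.1, pi_pos], ht.2⟩
  have hs : 0 ≤ sin t := sin_nonneg_of_nonneg_of_le_pi ht.1 (by linarith [ht.2, pi_pos])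
  have h := sin_sq_add_cos_sq t
  rcases hc.eq_or_lt with h0 | h0
  · have : 0 < sin t := by
      rcases hs.eq_or_lt with h1 | h1
      · rw [← h0, ← h1] at h; norm_num at h
      · exact h1
    positivity
  · positivity

lemma hasDerivAt_linear_form (a b t : ℝ) :
    HasDerivAt (fun t => a * cos t + b * sin t) (a * (-sin t) + b * cos t) t :=
  ((hasDerivAt_cos t).const_mul a).add ((hasDerivAt_sin t).const_mul b)

lemma lintegral_sin_pow_div_le {a b w : ℝ} (ha : 0 < a) (hb : 0 < b) (hw : 0 ≤ w) {k m : ℕ}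
    (hkm : k ≤ m) :
    ∫⁻ t, ENNReal.ofReal (sin t ^ m * w / (a * cos t + b * sin t) ^ (k+2)) ∂quarterMeasure ≤
      ENNReal.ofReal (a⁻¹ * (w / b ^ (k+1))) := by
  have hk : (0 : ℝ) < k + 1 := by positivity
  have h := lintegral_quarter_le (f := fun t => sin t ^ m * w / (a * cos t + b * sin t) ^ (k+2))
    (g := fun t => w / ((k+1) * a) * (sin t / (a * cos t + b * sin t)) ^ (k+1))
    (g' := fun t => sin t ^ k * w / (a * cos t + b * sin t) ^ (k+2)) ?_ ?_ ?_ ?_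
  · refine h.trans (ENNReal.ofReal_le_ofReal ?_)
    simp only [sin_pi_div_two, cos_pi_div_two, sin_zero, cos_zero]
    rw [show w / ((k+1) * a) * (1 / (a * 0 + b * 1)) ^ (k+1)
      - w / ((k+1) * a) * (0 / (a * 1 + b * 0)) ^ (k+1) = a⁻¹ * (w / b ^ (k+1)) / (k+1) by
        simp; field_simp]
    exact div_le_self (by positivity) (by linarith [Nat.cast_nonneg (α := ℝ) k])
  · refine continuousOn_const.mul (ContinuousOn.pow (ContinuousOn.div (by fun_prop) (by fun_prop)
      fun t ht => (linear_form_pos ha hb ht).ne') _)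
  · intro t ht
    have hD := linear_form_pos ha hb (Ioo_subset_Icc_self ht)
    have h1 := (((hasDerivAt_sin t).div (hasDerivAt_linear_form a b t) hD.ne').pow (k+1)).const_mul
      (w / ((k+1) * a))
    refine h1.congr_deriv ?_
    have hW : cos t * (a * cos t + b * sin t) - sin t * (a * (-sin t) + b * cos t) = a := by
      linear_combination a * sin_sq_add_cos_sq t
    simp only [Pi.div_apply, hW, Nat.add_sub_cancel]
    push_cast
    rw [div_pow]
    generalize a * cos t + b * sin t = D at *
    field_simp
    ring
  · intro t ht
    have hD := linear_form_pos ha hb (Ioo_subset_Icc_self ht)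
    have hs := sin_pos_of_mem_quarter ht
    positivity
  · intro t ht
    have hD := linear_form_pos ha hb (Ioo_subset_Icc_self ht)
    have hs := sin_pos_of_mem_quarter ht
    have := pow_le_pow_of_le_one hs.le (sin_le_one t) hkm
    gcongr

lemma lintegral_inv_linear_form_le {a b : ℝ} (ha : 0 < a) (hb : 0 < b) (hba : b ≤ a) :
    ∫⁻ t, ENNReal.ofReal (a * cos t + b * sin t)⁻¹ ∂quarterMeasure ≤
      ENNReal.ofReal (3 / a * log (1 + a / b)) := by
  have hc : 0 < 1 + b / a := by positivity
  have hc2 : b / a ≤ 1 := (div_le_one ha).2 hba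
  have h := lintegral_quarter_le (f := fun t => (a * cos t + b * sin t)⁻¹)
    (g := fun t => 3 / a * (log (1 * cos t + (1 + b / a) * sin t) - log (a * cos t + b * sin t)))
    (g' := fun t => 3 / ((1 * cos t + (1 + b / a) * sin t) * (a * cos t + b * sin t)))
    ?_ ?_ ?_ ?_
  · refine h.trans (ENNReal.ofReal_le_ofReal (le_of_eq ?_))
    simp only [sin_pi_div_two, cos_pi_div_two, sin_zero, cos_zero]
    rw [show 1 + a / b = (1 + b / a) * a / b by field_simp; ring,
      log_div (by positivity) hb.ne', log_mul hc.ne' ha.ne']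
    simp
    ring
  · refine continuousOn_const.mul (ContinuousOn.sub ?_ ?_)
    · exact ContinuousOn.log (by fun_prop) fun t ht => (linear_form_pos one_pos hc ht).ne'
    · exact ContinuousOn.log (by fun_prop) fun t ht => (linear_form_pos ha hb ht).ne'
  · intro t ht
    have hD := linear_form_pos ha hb (Ioo_subset_Icc_self ht)
    have hU := linear_form_pos one_pos hc (Ioo_subset_Icc_self ht)
    refine ((((hasDerivAt_linear_form 1 (1 + b / a) t).log hU.ne').sub
      ((hasDerivAt_linear_form a b t).log hD.ne')).const_mul (3 / a)).congr_deriv ?_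
    rw [div_sub_div _ _ hU.ne' hD.ne', show
      (1 * -sin t + (1 + b / a) * cos t) * (a * cos t + b * sin t) -
        (1 * cos t + (1 + b / a) * sin t) * (a * -sin t + b * cos t) = a by
        field_simp
        linear_combination a ^ 2 * sin_sq_add_cos_sq t]
    field_simp
  · intro t ht
    have hD := linear_form_pos ha hb (Ioo_subset_Icc_self ht)
    have hU := linear_form_pos one_pos hc (Ioo_subset_Icc_self ht)
    positivity
  · intro t ht
    have hD := linear_form_pos ha hb (Ioo_subset_Icc_self ht)
    have hU := linear_form_pos one_pos hc (Ioo_subset_Icc_self ht)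
    have hs := sin_pos_of_mem_quarter ht
    have hU3 : 1 * cos t + (1 + b / a) * sin t ≤ 3 := by
      nlinarith [sin_le_one t, cos_le_one t]
    rw [inv_eq_one_div, div_le_div_iff₀ hD (by positivity)]
    nlinarith

lemma log_one_add_le {x : ℝ} (hx : 1 ≤ x) : log (1 + x) ≤ 2 * max 1 (log x) := by
  have h1 : log (1 + x) ≤ log (2 * x) := log_le_log (by linarith) (by linarith)
  rw [log_mul (by norm_num) (by linarith)] at h1
  linarith [le_max_left 1 (log x), le_max_right 1 (log x), log_two_lt_d9]

lemma octantLintegral_succ_le {n k : ℕ} (hk : k ≤ n) {a : Fin (n+2) → ℝ} (ha : ∀ i, 0 < a i) :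
    octantLintegral (n+1) (k+2) a ≤
      ENNReal.ofReal (a 0)⁻¹ * octantLintegral n (k+1) (Fin.tail a) := by
  unfold octantLintegral
  rw [lintegral_pi_succ _ _ (by fun_prop), ← lintegral_const_mul _ (by fun_prop)]
  refine lintegral_mono_ae ((ae_mem_quarter n).mono fun y hy => ?_)
  rw [← ENNReal.ofReal_mul (inv_nonneg.2 (ha 0).le)]
  simp only [octantForm_cons, octantWeight_cons]
  exact lintegral_sin_pow_div_le (ha 0) (octantForm_pos (fun i => ha i.succ) hy)
    (octantWeight_nonneg hy) hk

lemma octantLintegral_one_le (n : ℕ) : ∃ C : ℝ, 0 ≤ C ∧ ∀ a : Fin (n+2) → ℝ, (∀ i, 0 < a i) →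
    a 1 ≤ a 0 → octantLintegral (n+1) 1 a ≤
      ENNReal.ofReal (C * (a 0)⁻¹ * max 1 (log (a 0 / a 1))) := by
  obtain _ | n := n
  · refine ⟨6, by norm_num, fun a ha h10 => ?_⟩
    unfold octantLintegral
    rw [lintegral_pi_succ _ _ (by fun_prop)]
    simp only [octantForm_cons, octantWeight_cons]
    rw [Measure.pi_of_empty, lintegral_dirac]
    simp only [octantForm, octantWeight, Fin.tail]
    simp
    refine (lintegral_inv_linear_form_le (ha 0) (ha 1) h10).trans (ENNReal.ofReal_le_ofReal ?_)
    have := log_one_add_le ((one_le_div (ha 1)).2 h10)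
    calc _ ≤ 3 / a 0 * (2 * max 1 (log (a 0 / a 1))) := by
          have := ha 0
          gcongr
      _ = _ := by ring
  · set M : ENNReal := Measure.pi (fun _ : Fin n => quarterMeasure) univ with hM
    set L : ENNReal := ∫⁻ t, ENNReal.ofReal (2 - log (cos t)) ∂quarterMeasure with hL
    have hMtop : M ≠ ⊤ := measure_ne_top _ _
    have hLtop : L ≠ ⊤ := by
      have hlog : IntegrableOn (log ∘ cos) (Ioc 0 (π/2)) :=
        (intervalIntegrable_iff_integrableOn_Ioc_of_le (by positivity)).1
          intervalIntegrable_log_cos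
      have hint : Integrable (fun t => 2 - log (cos t)) quarterMeasure :=
        (integrable_const 2).sub (hlog.mono_set Ioo_subset_Ioc_self)
      exact hint.lintegral_lt_top.ne
    refine ⟨3 * L.toReal * M.toReal, by positivity, fun a ha h10 => ?_⟩
    have h0 := ha 0
    have h1 := ha 1
    have hmax : 1 ≤ max 1 (log (a 0 / a 1)) := le_max_left _ _
    have step : octantLintegral (n+2) 1 a ≤
        ∫⁻ y, ENNReal.ofReal (3 / a 0 * max 1 (log (a 0 / a 1)) * (2 - log (cos (y 0))))
          ∂(Measure.pi fun _ : Fin (n+1) => quarterMeasure) := by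
      unfold octantLintegral
      rw [lintegral_pi_succ _ _ (by fun_prop)]
      refine lintegral_mono_ae ((ae_mem_quarter _).mono fun y hy => ?_)
      have hcos := cos_pos_of_mem_quarter (hy 0)
      have hb : 0 < a 1 * cos (y 0) := mul_pos h1 hcos
      have hb1 : a 1 * cos (y 0) ≤ a 1 := mul_le_of_le_one_right h1.le (cos_le_one _)
      have hform : a 1 * cos (y 0) ≤ octantForm (n+1) (Fin.tail a) y := by
        have := octantForm_cons n (Fin.tail a) (y 0) (Fin.tail y)
        rw [Fin.cons_self_tail] at this
        have h2 : 0 < octantForm n (Fin.tail (Fin.tail a)) (Fin.tail y) :=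
          octantForm_pos (fun i => ha _) fun i => hy _
        have h3 := sin_pos_of_mem_quarter (hy 0)
        have h4 : Fin.tail a 0 = a 1 := rfl
        rw [this, h4]
        linarith [mul_pos h2 h3]
      calc _ ≤ ∫⁻ t, ENNReal.ofReal (a 0 * cos t + a 1 * cos (y 0) * sin t)⁻¹
            ∂quarterMeasure := by
            refine lintegral_mono_ae (ae_mem_quarterMeasure.mono fun t ht => ?_)
            refine ENNReal.ofReal_le_ofReal ?_
            rw [octantForm_cons, octantWeight_cons, pow_one, inv_eq_one_div]
            have hs := sin_pos_of_mem_quarter ht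
            refine div_le_div₀ zero_le_one ?_
              (linear_form_pos h0 hb (Ioo_subset_Icc_self ht)) (by gcongr)
            exact mul_le_one₀ (pow_le_one₀ hs.le (sin_le_one _)) (octantWeight_nonneg hy)
              (octantWeight_le_one hy)
        _ ≤ _ := lintegral_inv_linear_form_le h0 hb (hb1.trans h10)
        _ ≤ _ := by
            refine ENNReal.ofReal_le_ofReal ?_
            rw [mul_assoc]
            refine mul_le_mul_of_nonneg_left ?_ (by positivity)
            have e1 : log (1 + a 0 / (a 1 * cos (y 0))) ≤
                log ((1 + a 0 / a 1) / cos (y 0)) := by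
              refine log_le_log (by positivity) ?_
              rw [add_div, div_div]
              gcongr
              exact (one_le_div hcos).2 (cos_le_one _)
            rw [log_div (by positivity) hcos.ne'] at e1
            have e2 := log_one_add_le ((one_le_div h1).2 h10)
            have e3 : log (cos (y 0)) ≤ 0 := log_nonpos hcos.le (cos_le_one _)
            nlinarith
    refine step.trans (le_of_eq ?_)
    rw [lintegral_pi_succ _ _ (by fun_prop)]
    simp only [Fin.cons_zero]
    rw [lintegral_const, ← hM]
    have hpos : 0 ≤ 3 / a 0 * max 1 (log (a 0 / a 1)) := by positivity
    simp only [ENNReal.ofReal_mul hpos]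
    rw [lintegral_const_mul _ (by fun_prop), ← hL, ← ENNReal.ofReal_toReal hMtop,
      ← ENNReal.ofReal_toReal hLtop, ← ENNReal.ofReal_mul hpos, ← ENNReal.ofReal_mul (by positivity)]
    congr 1
    simp only [ENNReal.toReal_ofReal ENNReal.toReal_nonneg]
    ring

lemma octantLintegral_le (k : ℕ) : ∀ n : ℕ, ∀ hk : k + 1 ≤ n, ∃ C : ℝ, 0 ≤ C ∧
    ∀ a : Fin (n+1) → ℝ, (∀ i, 0 < a i) → Antitone a → octantLintegral n (k+1) a ≤
      ENNReal.ofReal (C * (∏ i : Fin (k+1), (a (Fin.castLE (by omega) i))⁻¹) *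
        max 1 (log (a ⟨k, by omega⟩ / a ⟨k+1, by omega⟩))) := by
  induction k with
  | zero =>
    intro n hk
    obtain ⟨n, rfl⟩ := Nat.exists_eq_add_of_le' hk
    obtain ⟨C, hC, h⟩ := octantLintegral_one_le n
    refine ⟨C, hC, fun a ha hanti => ?_⟩
    simpa using h a ha (hanti (Fin.zero_le _))
  | succ k ih =>
    intro n hk
    obtain ⟨n, rfl⟩ := Nat.exists_eq_add_of_le' (show 1 ≤ n by omega)
    obtain ⟨C, hC, h⟩ := ih n (by omega)
    refine ⟨C, hC, fun a ha hanti => ?_⟩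
    refine (octantLintegral_succ_le (by omega) ha).trans ?_
    refine (mul_le_mul_right (h (Fin.tail a) (fun i => ha _)
      fun i j hij => hanti (Fin.succ_le_succ_iff.2 hij)) _).trans (le_of_eq ?_)
    rw [← ENNReal.ofReal_mul (inv_nonneg.2 (ha 0).le), Fin.prod_univ_succ (n := k+1)]
    congr 1
    simp only [Fin.tail, Fin.castLE_zero, Fin.castLE_succ, Fin.succ_mk]
    ring

lemma S_le_octantLintegral (n β : ℕ) (a : Fin (n+1) → ℝ) (ha : ∀ i, 0 < a i) :
    S n (β : ℝ) a ≤ (octantLintegral n β a).toReal := by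
  have h : S n (β : ℝ) a = ∫ θ, octantWeight n θ / octantForm n a θ ^ β
      ∂(Measure.pi fun _ : Fin n => quarterMeasure) := by
    unfold S quarterMeasure
    rw [volume_pi, Measure.restrict_pi_pi]
    simp only [rpow_natCast, Measure.restrict_congr_set Ioo_ae_eq_Icc]
    rfl
  rw [h, integral_eq_lintegral_of_nonneg_ae]
  · rfl
  · filter_upwards [ae_mem_quarter n] with θ hθ
    exact div_nonneg (octantWeight_nonneg hθ) (pow_nonneg (octantForm_pos ha hθ).le _)
  · exact Measurable.aestronglyMeasurable (by fun_prop)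

theorem S_bound_beta_integer (n : ℕ) (hn : 1 ≤ n) (β : ℕ) (hβ1 : 1 ≤ β) (hβn : β ≤ n) :
    ∃ C : ℝ, ∀ a : Fin (n+1) → ℝ, (∀ i, 0 < a i) → Antitone a →
      (∀ i : Fin n, Real.sqrt 2 * a i.succ ≤ a i.castSucc) →
      S n (β : ℝ) a ≤ C * (∏ i : Fin β, (a (Fin.castLE (by omega) i))⁻¹) *
        ⨆ r : {r : Fin n // β ≤ (r : ℕ) + 1},
          max 1 (Real.log (a r.1.castSucc / a r.1.succ)) := by
  obtain ⟨k, rfl⟩ := Nat.exists_eq_add_of_le' hβ1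
  obtain ⟨C, hC, h⟩ := octantLintegral_le k n hβn
  refine ⟨C, fun a ha hanti _ => ?_⟩
  have hprod : 0 ≤ C * ∏ i : Fin (k+1), (a (Fin.castLE (by omega) i))⁻¹ :=
    mul_nonneg hC (Finset.prod_nonneg fun i _ => inv_nonneg.2 (ha _).le)
  refine (S_le_octantLintegral n (k+1) a ha).trans
    ((ENNReal.toReal_le_of_le_ofReal (by positivity) (h a ha hanti)).trans ?_)
  refine mul_le_mul_of_nonneg_left ?_ hprod
  exact le_ciSup (f := fun r : {r : Fin n // k + 1 ≤ (r : ℕ) + 1} =>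
    max 1 (Real.log (a r.1.castSucc / a r.1.succ))) (Set.finite_range _).bddAbove
    ⟨⟨k, by omega⟩, le_rfl⟩
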